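/- Let k ≥ 1 and let P ∈ W⁺_{2k}. Then for all irrational real numbers x: P^Γ(x+1) = P^Γ(x), P^Γ(−x) = P^Γ(x), and P^Γ(x) − x^{2k} P^Γ(−1/x) = −P(x). That is, P^Γ is even, periodic of period 1, and satisfies P^Γ|(1−S) = −P. -/

import Mathlib

open Polynomial Matrix

noncomputable section

abbrev Mat2 := Matrix (Fin 2) (Fin 2) ℤ

/-- The matrix `Tⁿ = [[1,n],[0,1]]`. -/
def Tpow (n : ℤ) : Mat2 := !![1, n; 0, 1]

/-- The matrix `ε = [[0,1],[1,0]]`. -/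
def Meps : Mat2 := !![0, 1; 1, 0]

/-- The matrix `S = [[0,-1],[1,0]]`. -/
def MS : Mat2 := !![0, -1; 1, 0]

/-- The matrix `T = [[1,1],[0,1]]`. -/
def MT : Mat2 := !![1, 1; 0, 1]

/-- The matrix `σ = [[-1,0],[0,1]]`. -/
def Msig : Mat2 := !![-1, 0; 0, 1]

/-- The matrix `U = TS = [[1,-1],[1,0]]`. -/
def MU : Mat2 := MT * MS

/-- Möbius action of an integer matrix on a real number. -/
def moeb (M : Mat2) (x : ℝ) : ℝ :=
  ((M 0 0 : ℝ) * x + (M 0 1 : ℝ)) / ((M 1 0 : ℝ) * x + (M 1 1 : ℝ))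

/-- The sequence `x_i` of the (positive) continued fraction algorithm:
`x_0 = x`, `x_{i+1} = 1/(x_i - ⌊x_i⌋)`. -/
def cfX (x : ℝ) : ℕ → ℝ
  | 0 => x
  | i + 1 => 1 / (cfX x i - (⌊cfX x i⌋ : ℝ))

/-- The partial quotients `n_i = ⌊x_i⌋` of the continued fraction of `x`. -/
def cfN (x : ℝ) (i : ℕ) : ℤ := ⌊cfX x i⌋

/-- The matrices `γ_0 = Id`, `γ_{i+1} = ε T^{-n_i} γ_i`. -/
def gam (x : ℝ) : ℕ → Mat2
  | 0 => 1
  | i + 1 => (Meps * Tpow (-(cfN x i))) * gam x i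

/-- `Γ(x) = {γ_1, γ_2, γ_3, …}`. -/
def GammaSet (x : ℝ) : Set Mat2 := {M | ∃ i, 1 ≤ i ∧ M = gam x i}

/-- The matrices `γ'_0 = Id`, `γ'_{i+1} = Tγ'_i` if `γ'_i(x) ≤ 0`,
`T^{-1}εγ'_i` if `0 < γ'_i(x) ≤ 1`, and `T^{-1}γ'_i` if `γ'_i(x) > 1`. -/
def gam' (x : ℝ) : ℕ → Mat2
  | 0 => 1
  | i + 1 =>
    if moeb (gam' x i) x ≤ 0 then MT * gam' x i
    else if moeb (gam' x i) x ≤ 1 then (Tpow (-1) * Meps) * gam' x i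
    else Tpow (-1) * gam' x i

/-- `Γ(x)' = {γ'_1, γ'_2, γ'_3, …}`. -/
def GammaSet' (x : ℝ) : Set Mat2 := {M | ∃ i, 1 ≤ i ∧ M = gam' x i}

/-- The sequence `x_i` of the negative continued fraction algorithm:
`x_0 = x`, `x_{i+1} = 1/(⌈x_i⌉ - x_i)`. -/
def ncfX (x : ℝ) : ℕ → ℝ
  | 0 => x
  | i + 1 => 1 / ((⌈ncfX x i⌉ : ℝ) - ncfX x i)

/-- The partial quotients `m_i = ⌈x_i⌉` of the negative continued fraction of `x`. -/
def ncfM (x : ℝ) (i : ℕ) : ℤ := ⌈ncfX x i⌉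

/-- The matrices `γ̃_0 = Id`, `γ̃_{i+1} = S T^{-m_i} γ̃_i`. -/
def gamt (x : ℝ) : ℕ → Mat2
  | 0 => 1
  | i + 1 => (MS * Tpow (-(ncfM x i))) * gamt x i

/-- `Γ₁(x) = {γ̃_1, γ̃_2, γ̃_3, …}`. -/
def Gamma1Set (x : ℝ) : Set Mat2 := {M | ∃ i, 1 ≤ i ∧ M = gamt x i}

/-- A binary quadratic polynomial `aX² + bX + c`, encoded as the triple `(a,b,c)`. -/
abbrev QF := ℤ × ℤ × ℤ

/-- The value of `aX² + bX + c` at a real number `x`. -/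
def Qval (q : QF) (x : ℝ) : ℝ := (q.1 : ℝ) * x ^ 2 + (q.2.1 : ℝ) * x + (q.2.2 : ℝ)

/-- The value of `aX² + bX + c` at an integer `m`. -/
def QvalZ (q : QF) (m : ℤ) : ℤ := q.1 * m ^ 2 + q.2.1 * m + q.2.2

/-- The discriminant `b² - 4ac`. -/
def Qdisc (q : QF) : ℤ := q.2.1 ^ 2 - 4 * q.1 * q.2.2

/-- The homogenized value `a r² + b r t + c t²`; for `t ≠ 0` its sign is that of `Q(r/t)`,
and for `t = 0` that of the leading coefficient, i.e. of `Q(∞)`. -/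
def Qhom (q : QF) (r t : ℤ) : ℤ := q.1 * r ^ 2 + q.2.1 * r * t + q.2.2 * t ^ 2

/-- The weight 2 action `(Q|γ)(X) = (tX+u)² Q((rX+s)/(tX+u))` on quadratic polynomials,
for `γ = [[r,s],[t,u]]`. -/
def qslash (M : Mat2) (q : QF) : QF :=
  (Qhom q (M 0 0) (M 1 0),
   2 * q.1 * M 0 0 * M 0 1 + q.2.1 * (M 0 0 * M 1 1 + M 0 1 * M 1 0) + 2 * q.2.2 * M 1 0 * M 1 1,
   Qhom q (M 0 1) (M 1 1))

/-- The set `𝒬` of integral quadratic polynomials with positive non-square discriminant. -/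
def Qset : Set QF := {q | 0 < Qdisc q ∧ ¬ IsSquare (Qdisc q)}

/-- `A` is a `Γ`-equivalence class in `𝒬`, where `Γ = PGL₂(ℤ)`. -/
def IsClassQ (A : Set QF) : Prop :=
  ∃ q₀ ∈ Qset, A = {q ∈ Qset | ∃ M : Mat2, IsUnit M.det ∧ q = qslash M q₀}

/-- `B` is a `Γ₁`-equivalence class in `𝒬`, where `Γ₁ = PSL₂(ℤ)`. -/
def IsClassQ1 (B : Set QF) : Prop :=
  ∃ q₀ ∈ Qset, B = {q ∈ Qset | ∃ M : Mat2, M.det = 1 ∧ q = qslash M q₀}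

/-- `A^Sim = {Q ∈ A : Q(0) < 0 < Q(∞)}`. -/
def QSim (A : Set QF) : Set QF := {q ∈ A | q.2.2 < 0 ∧ 0 < q.1}

/-- `A^Red = {Q ∈ A : Q(∞) > 0, Q(-1) < 0 < Q(0)}`. -/
def QRed (A : Set QF) : Set QF := {q ∈ A | 0 < q.1 ∧ q.1 - q.2.1 + q.2.2 < 0 ∧ 0 < q.2.2}

/-- `A⟨x⟩ = {Q ∈ A : Q(∞) < 0 < Q(x)}`. -/
def QxSet (A : Set QF) (x : ℝ) : Set QF := {q ∈ A | q.1 < 0 ∧ 0 < Qval q x}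

/-- `𝒬_D⟨x⟩`, the set of quadratics of discriminant `D` with `Q(∞) < 0 < Q(x)`. -/
def QDx (D : ℕ) (x : ℝ) : Set QF :=
  {q | Qdisc q = (D : ℤ) ∧ q.1 < 0 ∧ 0 < Qval q x}

/-- The simple forms of discriminant `D`: `a > 0 > c`. -/
def SimpleD (D : ℕ) : Set QF := {q | Qdisc q = (D : ℤ) ∧ 0 < q.1 ∧ q.2.2 < 0}

/-- The reduced forms of discriminant `D`: `a > 0`, `c > 0`, `b > a + c`. -/
def ReducedD (D : ℕ) : Set QF :=
  {q | Qdisc q = (D : ℤ) ∧ 0 < q.1 ∧ 0 < q.2.2 ∧ q.1 + q.2.2 < q.2.1}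

/-- Homogenized evaluation of a polynomial of degree ≤ d: `∑ P_j r^j t^{d-j}`;
for `t ≠ 0` its sign is that of `P(r/t)` (`d` even), and for `t = 0` that of `P(∞)`. -/
def homEval (d : ℕ) (P : Polynomial ℤ) (r t : ℤ) : ℤ :=
  ∑ j ∈ Finset.range (d + 1), P.coeff j * r ^ j * t ^ (d - j)

/-- The weight `d` action `(P|γ)(X) = (tX+u)^d P((rX+s)/(tX+u))` on integral polynomials
of degree at most `d`, for `γ = [[r,s],[t,u]]`. -/
def pslash (d : ℕ) (M : Mat2) (P : Polynomial ℤ) : Polynomial ℤ :=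
  ∑ j ∈ Finset.range (d + 1),
    C (P.coeff j) * (C (M 0 0) * X + C (M 0 1)) ^ j * (C (M 1 0) * X + C (M 1 1)) ^ (d - j)

/-- `P` has exactly two real roots `w ≠ w'`, both irrational. -/
def HasTwoIrratRoots (P : Polynomial ℤ) (w w' : ℝ) : Prop :=
  w ≠ w' ∧ Irrational w ∧ Irrational w' ∧ ∀ y : ℝ, Polynomial.aeval y P = 0 ↔ y = w ∨ y = w'

/-- `F_d`: integral polynomials of degree ≤ d with exactly two real roots, both irrational. -/
def Fd (d : ℕ) : Set (Polynomial ℤ) :=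
  {P | P.natDegree ≤ d ∧ ∃ w w' : ℝ, HasTwoIrratRoots P w w'}

/-- `A` is a `Γ`-equivalence class in `F_d`, where `Γ = PGL₂(ℤ)`. -/
def IsClassF (d : ℕ) (A : Set (Polynomial ℤ)) : Prop :=
  ∃ P₀ ∈ Fd d, A = {P ∈ Fd d | ∃ M : Mat2, IsUnit M.det ∧ P = pslash d M P₀}

/-- `B` is a `Γ₁`-equivalence class in `F_d`, where `Γ₁ = PSL₂(ℤ)`. -/
def IsClassF1 (d : ℕ) (B : Set (Polynomial ℤ)) : Prop :=
  ∃ P₀ ∈ Fd d, B = {P ∈ Fd d | ∃ M : Mat2, M.det = 1 ∧ P = pslash d M P₀}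

/-- `A^Sim = {P ∈ A : P(0) < 0 < P(∞)}`, where `P(∞)` is the coefficient of `X^d`. -/
def PSim (d : ℕ) (A : Set (Polynomial ℤ)) : Set (Polynomial ℤ) :=
  {P ∈ A | P.coeff 0 < 0 ∧ 0 < P.coeff d}

/-- `A^Red = {P ∈ A : P(∞) > 0 and P(-1) < 0 < P(0)}`. -/
def PRed (d : ℕ) (A : Set (Polynomial ℤ)) : Set (Polynomial ℤ) :=
  {P ∈ A | 0 < P.coeff d ∧ Polynomial.aeval (-1 : ℤ) P < 0 ∧ 0 < P.coeff 0}

/-- `A⟨x⟩ = {P ∈ A : P(∞) < 0 < P(x)}`. -/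
def Px (d : ℕ) (A : Set (Polynomial ℤ)) (x : ℝ) : Set (Polynomial ℤ) :=
  {P ∈ A | P.coeff d < 0 ∧ 0 < Polynomial.aeval x P}

/-- The numerators of the convergents, shifted by 2: `pconv x i = p_{i-2}`. -/
def pconv (x : ℝ) : ℕ → ℤ
  | 0 => 0
  | 1 => 1
  | i + 2 => cfN x i * pconv x (i + 1) + pconv x i

/-- The denominators of the convergents, shifted by 2: `qconv x i = q_{i-2}`. -/
def qconv (x : ℝ) : ℕ → ℤ
  | 0 => 1
  | 1 => 0
  | i + 2 => cfN x i * qconv x (i + 1) + qconv x i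

/-- `δ_i = (-1)^i (p_{i-1} - q_{i-1} x)` for `i ≥ 0`. -/
def cfDelta (x : ℝ) (i : ℕ) : ℝ :=
  (-1 : ℝ) ^ i * ((pconv x (i + 1) : ℝ) - (qconv x (i + 1) : ℝ) * x)

/-- The weight `d` action `(P|γ)(X) = (tX+u)^d P((rX+s)/(tX+u))` on complex polynomials
of degree at most `d`, for `γ = [[r,s],[t,u]]` with integer entries. -/
def cslash (d : ℕ) (M : Mat2) (P : Polynomial ℂ) : Polynomial ℂ :=
  ∑ j ∈ Finset.range (d + 1),
    C (P.coeff j) * (C (M 0 0 : ℂ) * X + C (M 0 1 : ℂ)) ^ j *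
      (C (M 1 0 : ℂ) * X + C (M 1 1 : ℂ)) ^ (d - j)

/-- `P^Γ(x) = ∑_{γ ∈ Γ(x)} (P|γ)(x)` for `P` of degree ≤ 2k. -/
def PGam (k : ℕ) (P : Polynomial ℂ) (x : ℝ) : ℂ :=
  ∑' γ : GammaSet x, Polynomial.eval (x : ℂ) (cslash (2 * k) γ.1 P)

/-- The homogenization of degree `2k` of `P`, evaluated at a pair of real numbers. -/
def homC (k : ℕ) (P : Polynomial ℂ) (a b : ℝ) : ℂ :=
  ∑ j ∈ Finset.range (2 * k + 1), P.coeff j * (a : ℂ) ^ j * (b : ℂ) ^ (2 * k - j)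

/-- The product `{x_0} ⋯ {x_{i-1}}` of the fractional parts of the complete quotients of `x`. -/
def fractProd (x : ℝ) (i : ℕ) : ℝ := ∏ j ∈ Finset.range i, Int.fract (cfX x j)

theorem eval_cslash (k : ℕ) (P : Polynomial ℂ) (M : Mat2) (x : ℝ) :
    (cslash (2 * k) M P).eval (x : ℂ) =
      homC k P (M 0 0 * x + M 0 1) (M 1 0 * x + M 1 1) := by
  simp [cslash, homC, eval_finsetSum]

theorem homC_one_right {k : ℕ} {P : Polynomial ℂ} (hP : P.natDegree ≤ 2 * k) (x : ℝ) :
    homC k P x 1 = P.eval (x : ℂ) := by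
  rw [eval_eq_sum_range' (Nat.lt_succ_of_le hP)]
  simp [homC]

theorem homC_mul (k : ℕ) (P : Polynomial ℂ) (c a b : ℝ) :
    homC k P (c * a) (c * b) = (c : ℂ) ^ (2 * k) * homC k P a b := by
  simp only [homC, Finset.mul_sum]
  refine Finset.sum_congr rfl fun j hj => ?_
  have h : 2 * k = j + (2 * k - j) := by have := Finset.mem_range.mp hj; omega
  have h' : (c : ℂ) ^ (2 * k) = (c : ℂ) ^ j * (c : ℂ) ^ (2 * k - j) := by rw [← pow_add, ← h]
  rw [h']
  push_cast
  ring

theorem homC_neg_left {k : ℕ} {P : Polynomial ℂ} (hEven : ∀ n : ℕ, Odd n → P.coeff n = 0)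
    (a b : ℝ) : homC k P (-a) b = homC k P a b := by
  refine Finset.sum_congr rfl fun j _ => ?_
  rcases Nat.even_or_odd j with h | h
  · push_cast
    rw [h.neg_pow]
  · simp [hEven j h]

theorem homC_swap {k : ℕ} {P : Polynomial ℂ}
    (hEven : ∀ n : ℕ, Odd n → P.coeff n = 0) (hS : P + cslash (2 * k) MS P = 0)
    (x : ℝ) : homC k P 1 x = -P.eval (x : ℂ) := by
  have h := congrArg (eval (x : ℂ)) hS
  rw [eval_add, eval_cslash] at h
  have h1 := homC_neg_left (k := k) hEven 1 x
  simp only [MS, of_apply, cons_val', cons_val_zero, cons_val_one, cons_val_fin_one,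
    Int.cast_zero, Int.cast_one, Int.cast_neg, zero_mul, zero_add, one_mul, add_zero,
    eval_zero, h1] at h
  linear_combination h

theorem homC_antisymm {k : ℕ} {P : Polynomial ℂ} (hP : P.natDegree ≤ 2 * k)
    (hEven : ∀ n : ℕ, Odd n → P.coeff n = 0) (hS : P + cslash (2 * k) MS P = 0)
    {a b : ℝ} (hb : b ≠ 0) : homC k P b a = -homC k P a b := by
  have h := homC_swap hEven hS (a / b)
  rw [← homC_one_right hP] at h
  have h1 := homC_mul k P b 1 (a / b)
  have h2 := homC_mul k P b (a / b) 1
  rw [mul_div_cancel₀ a hb, mul_one] at h1 h2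
  rw [h1, h2, h]
  ring

theorem homC_three_term {k : ℕ} {P : Polynomial ℂ} (hP : P.natDegree ≤ 2 * k)
    (hEven : ∀ n : ℕ, Odd n → P.coeff n = 0) (hS : P + cslash (2 * k) MS P = 0)
    (hU : P + cslash (2 * k) MU P + cslash (2 * k) (MU * MU) P = 0)
    {y : ℝ} (h0 : y ≠ 0) (h1 : y ≠ 1) :
    homC k P 1 (1 - y) + homC k P (1 - y) y = homC k P 1 y := by
  have h := congrArg (eval ((1 / y : ℝ) : ℂ)) hU
  rw [eval_add, eval_add, eval_cslash, eval_cslash, ← homC_one_right hP] at h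
  simp [MU, MT, MS, Matrix.mul_apply, Fin.sum_univ_two] at h
  rw [homC_neg_left hEven] at h
  have e1 := homC_mul k P y y⁻¹ 1
  have e2 := homC_mul k P y (y⁻¹ + -1) y⁻¹
  have e3 := homC_mul k P y 1 (y⁻¹ + -1)
  rw [mul_add, mul_inv_cancel₀ h0, mul_neg_one, ← sub_eq_add_neg] at e2 e3
  rw [mul_one] at e3
  rw [mul_inv_cancel₀ h0, mul_one] at e1
  have s1 := homC_antisymm hP hEven hS (a := 1) (b := 1 - y) (sub_ne_zero.mpr h1.symm)
  have s2 := homC_antisymm hP hEven hS (a := 1 - y) (b := y) h0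
  linear_combination s1 + s2 - e1 - e2 - e3 - (y : ℂ) ^ (2 * k) * h

theorem norm_homC_le {k : ℕ} (P : Polynomial ℂ) {a b : ℝ} (hb : 0 ≤ b) (hba : b ≤ a) :
    ‖homC k P a b‖ ≤ (∑ j ∈ Finset.range (2 * k + 1), ‖P.coeff j‖) * a ^ (2 * k) := by
  rw [homC, Finset.sum_mul]
  refine (norm_sum_le _ _).trans (Finset.sum_le_sum fun j hj => ?_)
  have ha : 0 ≤ a := hb.trans hba
  have h : 2 * k = j + (2 * k - j) := by have := Finset.mem_range.mp hj; omega
  have h' : a ^ (2 * k) = a ^ j * a ^ (2 * k - j) := by rw [← pow_add, ← h]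
  rw [norm_mul, norm_mul, norm_pow, norm_pow, Complex.norm_real, Complex.norm_real,
    Real.norm_of_nonneg ha, Real.norm_of_nonneg hb, h', mul_assoc]
  gcongr

theorem cfX_succ (x : ℝ) (i : ℕ) : cfX x (i + 1) = 1 / Int.fract (cfX x i) := rfl

theorem cfX_succ' (x : ℝ) (i : ℕ) : cfX x (i + 1) = cfX (1 / Int.fract x) i := by
  induction i with
  | zero => rfl
  | succ i ih => rw [cfX_succ, ih, cfX_succ]

theorem irrational_fract {x : ℝ} (hx : Irrational x) : Irrational (Int.fract x) :=
  hx.sub_intCast _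

theorem irrational_one_div {x : ℝ} (hx : Irrational x) : Irrational (1 / x) := by
  rw [one_div]
  exact hx.inv

theorem irrational_cfX {x : ℝ} (hx : Irrational x) (i : ℕ) : Irrational (cfX x i) := by
  induction i with
  | zero => exact hx
  | succ i ih => exact irrational_one_div (irrational_fract ih)

theorem fract_pos_of_irrational {x : ℝ} (hx : Irrational x) : 0 < Int.fract x :=
  lt_of_le_of_ne (Int.fract_nonneg x) (irrational_fract hx).ne_zero.symm

theorem fractProd_succ (x : ℝ) (i : ℕ) :
    fractProd x (i + 1) = fractProd x i * Int.fract (cfX x i) :=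
  Finset.prod_range_succ _ _

theorem fractProd_succ' (x : ℝ) (i : ℕ) :
    fractProd x (i + 1) = Int.fract x * fractProd (1 / Int.fract x) i := by
  rw [fractProd, Finset.prod_range_succ', mul_comm]
  simp_rw [cfX_succ']
  rfl

theorem fractProd_pos {x : ℝ} (hx : Irrational x) (i : ℕ) : 0 < fractProd x i :=
  Finset.prod_pos fun j _ => fract_pos_of_irrational (irrational_cfX hx j)

theorem fractProd_succ_lt {x : ℝ} (hx : Irrational x) (i : ℕ) :
    fractProd x (i + 1) < fractProd x i := by
  rw [fractProd_succ]
  exact mul_lt_of_lt_one_right (fractProd_pos hx i) (Int.fract_lt_one _)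

theorem strictAnti_fractProd {x : ℝ} (hx : Irrational x) : StrictAnti (fractProd x) :=
  strictAnti_nat_of_succ_lt (fractProd_succ_lt hx)

theorem fractProd_le_one {x : ℝ} (hx : Irrational x) (i : ℕ) : fractProd x i ≤ 1 := by
  simpa [fractProd] using (strictAnti_fractProd hx).antitone (Nat.zero_le i)

theorem fractProd_add_two_le {x : ℝ} (hx : Irrational x) (i : ℕ) :
    fractProd x (i + 2) + fractProd x (i + 1) ≤ fractProd x i := by
  have hf := fract_pos_of_irrational (irrational_cfX hx i)
  have h1 : 1 ≤ 1 / Int.fract (cfX x i) := by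
    rw [le_div_iff₀ hf, one_mul]
    exact (Int.fract_lt_one _).le
  have h2 : Int.fract (1 / Int.fract (cfX x i)) ≤ 1 / Int.fract (cfX x i) - 1 := by
    have h3 : (1 : ℝ) ≤ ⌊1 / Int.fract (cfX x i)⌋ := by
      exact_mod_cast Int.le_floor.mpr (by exact_mod_cast h1)
    rw [Int.fract]
    linarith
  have h4 := mul_le_mul_of_nonneg_left h2 (fractProd_pos hx (i + 1)).le
  rw [fractProd_succ x (i + 1), cfX_succ]
  have h5 : fractProd x (i + 1) * (1 / Int.fract (cfX x i)) = fractProd x i := by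
    rw [fractProd_succ]
    field_simp
  linarith

theorem summable_fractProd {x : ℝ} (hx : Irrational x) : Summable (fractProd x) := by
  rw [← summable_nat_add_iff 1]
  refine summable_of_sum_range_le (c := fractProd x 0 + fractProd x 1)
    (fun n => (fractProd_pos hx _).le) fun n => ?_
  have key : ∑ i ∈ Finset.range n, fractProd x (i + 1) ≤
      fractProd x 0 + fractProd x 1 - (fractProd x n + fractProd x (n + 1)) := by
    induction n with
    | zero => simp
    | succ n ih =>
      rw [Finset.sum_range_succ]
      linarith [fractProd_add_two_le hx n]
  linarith [fractProd_pos hx n, fractProd_pos hx (n + 1)]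

theorem summable_homC_fractProd {k : ℕ} (hk : 1 ≤ k) (P : Polynomial ℂ) {x : ℝ}
    (hx : Irrational x) :
    Summable fun i => homC k P (fractProd x i) (fractProd x (i + 1)) := by
  refine Summable.of_norm_bounded ((summable_fractProd hx).mul_left
    (∑ j ∈ Finset.range (2 * k + 1), ‖P.coeff j‖)) fun i => ?_
  refine (norm_homC_le P (fractProd_pos hx _).le (fractProd_succ_lt hx i).le).trans ?_
  refine mul_le_mul_of_nonneg_left ?_ (Finset.sum_nonneg fun j _ => norm_nonneg _)
  exact pow_le_of_le_one (fractProd_pos hx i).le (fractProd_le_one hx i) (by omega)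

theorem gam_apply {x : ℝ} (hx : Irrational x) (i : ℕ) :
    (gam x i 0 0 : ℝ) * x + gam x i 0 1 = fractProd x i * cfX x i ∧
      (gam x i 1 0 : ℝ) * x + gam x i 1 1 = fractProd x i := by
  induction i with
  | zero => simp [gam, fractProd, cfX]
  | succ i ih =>
    obtain ⟨h0, h1⟩ := ih
    have hf := (fract_pos_of_irrational (irrational_cfX hx i)).ne'
    constructor
    · rw [cfX_succ, fractProd_succ, mul_assoc, mul_one_div_cancel hf, mul_one, ← h1]
      simp [gam, Meps, Tpow, Matrix.mul_apply, Fin.sum_univ_two]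
    · rw [fractProd_succ, Int.fract, mul_sub, ← h0]
      nth_rewrite 1 [← h1]
      simp [gam, Meps, Tpow, Matrix.mul_apply, Fin.sum_univ_two, cfN]
      ring

theorem PGam_eq_tsum (k : ℕ) (P : Polynomial ℂ) {x : ℝ} (hx : Irrational x) :
    PGam k P x = ∑' i, homC k P (fractProd x i) (fractProd x (i + 1)) := by
  have hset : GammaSet x = Set.range fun i => gam x (i + 1) := by
    ext M
    constructor
    · rintro ⟨i, hi, rfl⟩
      exact ⟨i - 1, by simp only [Nat.sub_add_cancel hi]⟩
    · rintro ⟨i, rfl⟩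
      exact ⟨i + 1, by omega, rfl⟩
  have hinj : Function.Injective fun i => gam x (i + 1) := by
    intro i j hij
    have h : fractProd x (i + 1) = fractProd x (j + 1) := by
      rw [← (gam_apply hx (i + 1)).2, ← (gam_apply hx (j + 1)).2]
      simp only at hij
      rw [hij]
    exact Nat.succ_injective ((strictAnti_fractProd hx).injective h)
  rw [PGam, hset, tsum_range (fun M => eval (x : ℂ) (cslash (2 * k) M P)) hinj]
  refine tsum_congr fun i => ?_
  have hf := (fract_pos_of_irrational (irrational_cfX hx i)).ne'
  rw [eval_cslash, (gam_apply hx (i + 1)).1, (gam_apply hx (i + 1)).2, cfX_succ]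
  congr 1
  rw [fractProd_succ, mul_assoc, mul_one_div_cancel hf, mul_one]

theorem PGam_rec {k : ℕ} (hk : 1 ≤ k) (P : Polynomial ℂ) {x : ℝ} (hx : Irrational x) :
    PGam k P x = homC k P 1 (Int.fract x) +
      ((Int.fract x : ℝ) : ℂ) ^ (2 * k) * PGam k P (1 / Int.fract x) := by
  rw [PGam_eq_tsum k P hx, PGam_eq_tsum k P (irrational_one_div (irrational_fract hx)),
    (summable_homC_fractProd hk P hx).tsum_eq_zero_add, ← tsum_mul_left]
  congr 1
  · simp [fractProd, cfX]
  · refine tsum_congr fun i => ?_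
    rw [fractProd_succ', fractProd_succ', homC_mul]

theorem PGam_congr_fract {k : ℕ} (hk : 1 ≤ k) (P : Polynomial ℂ) {x y : ℝ}
    (hx : Irrational x) (hy : Irrational y) (h : Int.fract x = Int.fract y) :
    PGam k P x = PGam k P y := by
  rw [PGam_rec hk P hx, PGam_rec hk P hy, h]

theorem PGam_one_sub_of_lt_half {k : ℕ} (hk : 1 ≤ k) {P : Polynomial ℂ}
    (hP : P.natDegree ≤ 2 * k)
    (hEven : ∀ n : ℕ, Odd n → P.coeff n = 0) (hS : P + cslash (2 * k) MS P = 0)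
    (hU : P + cslash (2 * k) MU P + cslash (2 * k) (MU * MU) P = 0)
    {y : ℝ} (hy : Irrational y) (h0 : 0 < y) (h1 : y < 1 / 2) :
    PGam k P (1 - y) = PGam k P y := by
  have hy1 : Irrational (1 - y) := by simpa using hy.intCast_sub 1
  have hz : (0 : ℝ) < 1 - y := by linarith
  have hz' := irrational_one_div hy1
  have f1 : Int.fract (1 - y) = 1 - y := Int.fract_eq_self.mpr ⟨hz.le, by linarith⟩
  have f2 : Int.fract y = y := Int.fract_eq_self.mpr ⟨h0.le, by linarith⟩
  have f3 : Int.fract (1 / (1 - y)) = y / (1 - y) := by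
    have : 1 / (1 - y) = y / (1 - y) + 1 := by field_simp; ring
    rw [this, Int.fract_add_one]
    exact Int.fract_eq_self.mpr ⟨by positivity, by rw [div_lt_one hz]; linarith⟩
  have f4 : PGam k P (1 / (y / (1 - y))) = PGam k P (1 / y) := by
    refine PGam_congr_fract hk P (f3 ▸ irrational_one_div (irrational_fract hz'))
      (irrational_one_div hy) ?_
    have : 1 / y = 1 / (y / (1 - y)) + 1 := by field_simp; ring
    rw [this, Int.fract_add_one]
  have e := homC_mul k P (1 - y) 1 (y / (1 - y))
  rw [mul_one, mul_div_cancel₀ _ hz.ne'] at e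
  rw [PGam_rec hk P hy1, PGam_rec hk P hy, f1, f2, PGam_rec hk P hz', f3, f4,
    ← homC_three_term hP hEven hS hU h0.ne' (by linarith), e]
  have hp : ((1 - y : ℝ) : ℂ) ^ (2 * k) * ((y / (1 - y) : ℝ) : ℂ) ^ (2 * k) =
      (y : ℂ) ^ (2 * k) := by
    rw [← mul_pow, ← Complex.ofReal_mul, mul_div_cancel₀ _ hz.ne']
  linear_combination PGam k P (1 / y) * hp

theorem PGam_neg {k : ℕ} (hk : 1 ≤ k) {P : Polynomial ℂ} (hP : P.natDegree ≤ 2 * k)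
    (hEven : ∀ n : ℕ, Odd n → P.coeff n = 0) (hS : P + cslash (2 * k) MS P = 0)
    (hU : P + cslash (2 * k) MU P + cslash (2 * k) (MU * MU) P = 0)
    {x : ℝ} (hx : Irrational x) : PGam k P (-x) = PGam k P x := by
  have hf := irrational_fract hx
  have hf' : Irrational (1 - Int.fract x) := by simpa using hf.intCast_sub 1
  have hpos := fract_pos_of_irrational hx
  have e1 : PGam k P x = PGam k P (Int.fract x) :=
    PGam_congr_fract hk P hx hf (Int.fract_fract x).symm
  have e2 : PGam k P (-x) = PGam k P (1 - Int.fract x) := by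
    refine PGam_congr_fract hk P hx.neg hf' ?_
    rw [Int.fract_neg hpos.ne']
    exact (Int.fract_eq_self.mpr ⟨by linarith [Int.fract_lt_one x], by linarith⟩).symm
  rw [e1, e2]
  rcases lt_trichotomy (Int.fract x) (1 / 2) with h | h | h
  · exact PGam_one_sub_of_lt_half hk hP hEven hS hU hf hpos h
  · exact absurd h (by simpa using hf.ne_rat (1 / 2))
  · have := PGam_one_sub_of_lt_half hk hP hEven hS hU hf'
      (by linarith [Int.fract_lt_one x]) (by linarith)
    rw [sub_sub_cancel] at this
    exact this.symm

theorem PGam_sub_of_lt_one {k : ℕ} (hk : 1 ≤ k) (P : Polynomial ℂ) {x : ℝ}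
    (hx : Irrational x) (h0 : 0 < x) (h1 : x < 1) :
    PGam k P x - (x : ℂ) ^ (2 * k) * PGam k P (1 / x) = homC k P 1 x := by
  rw [PGam_rec hk P hx, Int.fract_eq_self.mpr ⟨h0.le, h1⟩]
  ring

theorem PGam_sub_of_pos {k : ℕ} (hk : 1 ≤ k) {P : Polynomial ℂ} (hP : P.natDegree ≤ 2 * k)
    (hEven : ∀ n : ℕ, Odd n → P.coeff n = 0) (hS : P + cslash (2 * k) MS P = 0)
    {x : ℝ} (hx : Irrational x) (h0 : 0 < x) :
    PGam k P x - (x : ℂ) ^ (2 * k) * PGam k P (1 / x) = -P.eval (x : ℂ) := by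
  rcases lt_or_gt_of_ne hx.ne_one with h1 | h1
  · rw [PGam_sub_of_lt_one hk P hx h0 h1, homC_swap hEven hS]
  · have h := PGam_sub_of_lt_one hk P (irrational_one_div hx) (by positivity)
      ((div_lt_one h0).mpr h1)
    rw [one_div_one_div] at h
    have e := homC_mul k P x 1 (1 / x)
    rw [mul_one, mul_one_div_cancel h0.ne', homC_one_right hP] at e
    have hp : (x : ℂ) ^ (2 * k) * ((1 / x : ℝ) : ℂ) ^ (2 * k) = 1 := by
      rw [← mul_pow, ← Complex.ofReal_mul, mul_one_div_cancel h0.ne']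
      simp
    linear_combination -(x : ℂ) ^ (2 * k) * h + e - PGam k P x * hp

/-- **Corollary of Theorem 6.** For `k ≥ 1` and `P ∈ W⁺_{2k}` (an even
polynomial of degree ≤ 2k with `P|(1+S) = 0` and `P|(1+U+U²) = 0`), the function `P^Γ`
is periodic of period 1, even, and satisfies `P^Γ|(1-S) = -P`, on irrational arguments. -/
theorem stmt15 (k : ℕ) (hk : 1 ≤ k) (P : Polynomial ℂ) (hP : P.natDegree ≤ 2 * k)
    (hEven : ∀ n : ℕ, Odd n → P.coeff n = 0)
    (hS : P + cslash (2 * k) MS P = 0)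
    (hU : P + cslash (2 * k) MU P + cslash (2 * k) (MU * MU) P = 0) :
    ∀ x : ℝ, Irrational x →
      PGam k P (x + 1) = PGam k P x ∧
      PGam k P (-x) = PGam k P x ∧
      PGam k P x - (x : ℂ) ^ (2 * k) * PGam k P (-(1 / x)) =
        -Polynomial.eval (x : ℂ) P := by
  intro x hx
  have hneg : ∀ {y : ℝ}, Irrational y → PGam k P (-y) = PGam k P y :=
    fun hy => PGam_neg hk hP hEven hS hU hy
  have hx1 : Irrational (x + 1) := by simpa using hx.add_intCast 1
  refine ⟨PGam_congr_fract hk P hx1 hx (Int.fract_add_one x), hneg hx, ?_⟩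
  rw [hneg (irrational_one_div hx)]
  rcases lt_or_gt_of_ne hx.ne_zero with h | h
  · have h' := PGam_sub_of_pos hk hP hEven hS hx.neg (neg_pos.mpr h)
    rw [hneg hx, one_div_neg_eq_neg_one_div, hneg (irrational_one_div hx),
      ← homC_one_right hP, homC_neg_left hEven, homC_one_right hP, Complex.ofReal_neg,
      (even_two_mul k).neg_pow] at h'
    exact h'
  · exact PGam_sub_of_pos hk hP hEven hS hx h
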